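/- Let t ≥ 2 be an integer and let H be a 3-partite 3-uniform hypergraph with parts A, B, C, each of size n. If H contains no copy of K_{2,t}^{(3)} and no copy of K_{1,2,2t}, then H has at most 2·t·n² edges. -/

import Mathlib

/-- A 3-uniform hypergraph `H` contains a copy of `K_{2,t}^{(3)}`: there are distinct
vertices `a, b, x_1, …, x_t, y_1, …, y_t` (i.e. `2t+2` distinct vertices) such that all
the triples `{a, x i, y i}` and `{b, x i, y i}` are edges of `H`. -/
def hasK2t3 {V : Type*} [DecidableEq V] (t : ℕ) (H : Finset (Finset V)) : Prop :=
  ∃ (a b : V) (x y : Fin t → V),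
    ({a, b} ∪ Finset.image x Finset.univ ∪ Finset.image y Finset.univ).card = 2 * t + 2 ∧
    ∀ i : Fin t,
      ({a, x i, y i} : Finset V) ∈ H ∧ ({b, x i, y i} : Finset V) ∈ H

/-- A 3-uniform hypergraph `H` contains a copy of `K_{1,2,q}`: there are distinct
vertices `x, a₁, a₂, y_1, …, y_q` (i.e. `q+3` distinct vertices) such that all the
triples `{x, a₁, y i}` and `{x, a₂, y i}` are edges of `H`. -/
def hasK12q {V : Type*} [DecidableEq V] (q : ℕ) (H : Finset (Finset V)) : Prop :=
  ∃ (x a₁ a₂ : V) (y : Fin q → V),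
    ({x, a₁, a₂} ∪ Finset.image y Finset.univ).card = q + 3 ∧
    ∀ i : Fin q,
      ({x, a₁, y i} : Finset V) ∈ H ∧ ({x, a₂, y i} : Finset V) ∈ H

theorem aux_graph {V : Type*} [DecidableEq V] (t D : ℕ) (ht : 2 ≤ t) (G : Finset (V × V))
    (hM : ∀ M ⊆ G, Set.InjOn Prod.fst (M : Set (V × V)) → Set.InjOn Prod.snd (M : Set (V × V)) →
      M.card ≤ t - 1)
    (h1 : ∀ b, (G.filter (fun p => p.1 = b)).card ≤ D)
    (h2 : ∀ c, (G.filter (fun p => p.2 = c)).card ≤ D) :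
    G.card ≤ (t - 1) * (D + D) := by
  classical
  let S : Finset (Finset (V × V)) := G.powerset.filter (fun M : Finset (V × V) => Set.InjOn Prod.fst (M : Set (V × V)) ∧
    Set.InjOn Prod.snd (M : Set (V × V)))
  have hS : S.Nonempty := ⟨∅, by simp [S]⟩
  obtain ⟨M, hMS, hmax⟩ := Finset.exists_max_image S Finset.card hS
  simp only [S, Finset.mem_filter, Finset.mem_powerset] at hMS hmax
  obtain ⟨hMG, hi1, hi2⟩ := hMS
  have hsub : G ⊆ M.biUnion (fun m => G.filter (fun p => p.1 = m.1) ∪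
      G.filter (fun p => p.2 = m.2)) := by
    intro p hp
    by_contra hcon
    have hno : ∀ m ∈ M, p.1 ≠ m.1 ∧ p.2 ≠ m.2 := by
      intro m hm
      constructor
      · intro h
        exact hcon (Finset.mem_biUnion.2 ⟨m, hm, by simp [hp, h]⟩)
      · intro h
        exact hcon (Finset.mem_biUnion.2 ⟨m, hm, by simp [hp, h]⟩)
    have hpM : p ∉ M := fun h => (hno p h).1 rfl
    have := hmax (insert p M) ⟨Finset.insert_subset hp hMG, by
      rw [Finset.coe_insert, Set.injOn_insert (by simpa using hpM)]
      refine ⟨hi1, ?_⟩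
      rintro ⟨m, hm, h⟩
      exact (hno m hm).1 h.symm, by
      rw [Finset.coe_insert, Set.injOn_insert (by simpa using hpM)]
      refine ⟨hi2, ?_⟩
      rintro ⟨m, hm, h⟩
      exact (hno m hm).2 h.symm⟩
    rw [Finset.card_insert_of_notMem hpM] at this
    omega
  calc G.card ≤ _ := Finset.card_le_card hsub
    _ ≤ M.card * (D + D) := by
      apply Finset.card_biUnion_le_card_mul
      intro m _
      exact (Finset.card_union_le _ _).trans (Nat.add_le_add (h1 _) (h2 _))
    _ ≤ (t - 1) * (D + D) := Nat.mul_le_mul_right _ (hM M hMG hi1 hi2)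

theorem aux_K12q {V : Type*} [DecidableEq V] (q : ℕ) (H : Finset (Finset V))
    (x a b : V) (Y : Finset V) (hxa : x ≠ a) (hxb : x ≠ b) (hab : a ≠ b)
    (hx : x ∉ Y) (ha : a ∉ Y) (hb : b ∉ Y)
    (hY : ∀ y ∈ Y, ({x, a, y} : Finset V) ∈ H ∧ ({x, b, y} : Finset V) ∈ H)
    (hc : q ≤ Y.card) : hasK12q q H := by
  obtain ⟨Z, hZ, hZc⟩ := Finset.exists_subset_card_eq hc
  let e := (Z.equivFinOfCardEq hZc).symm
  refine ⟨x, a, b, fun i => (e i : V), ?_, fun i => hY _ (hZ (e i).2)⟩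
  have him : Finset.image (fun i => (e i : V)) Finset.univ = Z := by
    ext v
    simp only [Finset.mem_image, Finset.mem_univ, true_and]
    constructor
    · rintro ⟨i, rfl⟩
      exact (e i).2
    · intro h
      exact ⟨e.symm ⟨v, h⟩, by simp⟩
  rw [him, Finset.card_union_of_disjoint, hZc, Finset.card_eq_three.2 ⟨x, a, b, hxa, hxb, hab, rfl⟩]
  · omega
  · rw [Finset.disjoint_left]
    intro v hv hvZ
    have := hZ hvZ
    simp only [Finset.mem_insert, Finset.mem_singleton] at hv
    rcases hv with rfl | rfl | rfl <;> contradiction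

theorem aux_K2t {V : Type*} [DecidableEq V] (t : ℕ) (H : Finset (Finset V))
    (A B C : Finset V)
    (hAB : Disjoint A B) (hAC : Disjoint A C) (hBC : Disjoint B C)
    (a b : V) (ha : a ∈ A) (hb : b ∈ A) (hab : a ≠ b) (M : Finset (V × V))
    (hM : M ⊆ B ×ˢ C) (hi1 : Set.InjOn Prod.fst (M : Set (V × V)))
    (hi2 : Set.InjOn Prod.snd (M : Set (V × V)))
    (hY : ∀ p ∈ M, ({a, p.1, p.2} : Finset V) ∈ H ∧ ({b, p.1, p.2} : Finset V) ∈ H)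
    (hc : t ≤ M.card) : hasK2t3 t H := by
  obtain ⟨Z, hZ, hZc⟩ := Finset.exists_subset_card_eq hc
  let e := (Z.equivFinOfCardEq hZc).symm
  have hB : ∀ i, (e i).1.1 ∈ B := fun i => (Finset.mem_product.1 (hM (hZ (e i).2))).1
  have hC : ∀ i, (e i).1.2 ∈ C := fun i => (Finset.mem_product.1 (hM (hZ (e i).2))).2
  refine ⟨a, b, fun i => (e i).1.1, fun i => (e i).1.2, ?_, fun i => hY _ (hZ (e i).2)⟩
  have sA : ({a, b} : Finset V) ⊆ A := by
    intro v hv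
    simp only [Finset.mem_insert, Finset.mem_singleton] at hv
    rcases hv with rfl | rfl <;> assumption
  have sB : Finset.image (fun i => (e i).1.1) Finset.univ ⊆ B := by
    intro v hv
    obtain ⟨i, _, rfl⟩ := Finset.mem_image.1 hv
    exact hB i
  have sC : Finset.image (fun i => (e i).1.2) Finset.univ ⊆ C := by
    intro v hv
    obtain ⟨i, _, rfl⟩ := Finset.mem_image.1 hv
    exact hC i
  rw [Finset.card_union_of_disjoint, Finset.card_union_of_disjoint,
    Finset.card_image_of_injective, Finset.card_image_of_injective, Finset.card_pair hab]
  · simp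
    omega
  · intro i j h
    exact e.injective (Subtype.ext (hi2 (hZ (e i).2) (hZ (e j).2) h))
  · intro i j h
    exact e.injective (Subtype.ext (hi1 (hZ (e i).2) (hZ (e j).2) h))
  · exact Finset.disjoint_of_subset_left sA (Finset.disjoint_of_subset_right sB hAB)
  · rw [Finset.disjoint_union_left]
    exact ⟨Finset.disjoint_of_subset_left sA (Finset.disjoint_of_subset_right sC hAC),
      Finset.disjoint_of_subset_left sB (Finset.disjoint_of_subset_right sC hBC)⟩

theorem aux_codeg {V : Type*} [DecidableEq V] (t : ℕ) (ht : 2 ≤ t)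
    (A B C : Finset V)
    (hAB : Disjoint A B) (hAC : Disjoint A C) (hBC : Disjoint B C)
    (H : Finset (Finset V))
    (hfree : ¬ hasK2t3 t H) (hfree' : ¬ hasK12q (2 * t) H)
    (a b : V) (ha : a ∈ A) (hb : b ∈ A) (hab : a ≠ b) :
    ((B ×ˢ C).filter (fun p => ({a, p.1, p.2} : Finset V) ∈ H ∧
      ({b, p.1, p.2} : Finset V) ∈ H)).card ≤ (t - 1) * ((2 * t - 1) + (2 * t - 1)) := by
  have nAB : ∀ v ∈ A, v ∉ B := fun v h h' => Finset.disjoint_left.1 hAB h h'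
  have nAC : ∀ v ∈ A, v ∉ C := fun v h h' => Finset.disjoint_left.1 hAC h h'
  have nBC : ∀ v ∈ B, v ∉ C := fun v h h' => Finset.disjoint_left.1 hBC h h'
  apply aux_graph t _ ht
  · intro M hM hi1 hi2
    by_contra hcon
    refine hfree (aux_K2t t H A B C hAB hAC hBC a b ha hb hab M
      (hM.trans (Finset.filter_subset _ _)) hi1 hi2 ?_ (by omega))
    intro p hp
    exact (Finset.mem_filter.1 (hM hp)).2
  · intro x
    by_contra hcon
    by_cases hx : x ∈ B
    swap
    · rw [Finset.filter_eq_empty_iff.2] at hcon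
      · simp at hcon
      · intro p hp h
        simp only [Finset.mem_filter, Finset.mem_product] at hp
        exact hx (h ▸ hp.1.1)
    let Y := C.filter (fun c => ({a, x, c} : Finset V) ∈ H ∧ ({b, x, c} : Finset V) ∈ H)
    refine hfree' (aux_K12q (2 * t) H x a b Y ?_ ?_ hab ?_ ?_ ?_ ?_ ?_)
    · rintro rfl; exact nAB _ ha hx
    · rintro rfl; exact nAB _ hb hx
    · exact fun h => nBC _ hx (Finset.mem_filter.1 h).1
    · exact fun h => nAC _ ha (Finset.mem_filter.1 h).1
    · exact fun h => nAC _ hb (Finset.mem_filter.1 h).1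
    · intro y hy
      rw [Finset.insert_comm x a, Finset.insert_comm x b]
      exact (Finset.mem_filter.1 hy).2
    · refine le_trans (show 2 * t ≤ _ from Nat.le_of_pred_lt (not_le.1 hcon)) (Finset.card_le_card_of_injOn (t := Y) Prod.snd ?_ ?_)
      · intro p hp
        simp only [Finset.coe_filter, Finset.mem_filter, Finset.mem_product, Set.mem_ofPred_eq] at hp
        obtain ⟨⟨⟨h1, h2⟩, h3, h4⟩, rfl⟩ := hp
        simp only [Y, Finset.coe_filter, Set.mem_ofPred_eq]
        exact ⟨h2, h3, h4⟩
      · intro p hp p2 hp2 h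
        simp only [Finset.coe_filter, Finset.mem_filter, Finset.mem_product, Set.mem_ofPred_eq] at hp hp2
        exact Prod.ext (hp.2.trans hp2.2.symm) h
  · intro x
    by_contra hcon
    by_cases hx : x ∈ C
    swap
    · rw [Finset.filter_eq_empty_iff.2] at hcon
      · simp at hcon
      · intro p hp h
        simp only [Finset.mem_filter, Finset.mem_product] at hp
        exact hx (h ▸ hp.1.2)
    let Y := B.filter (fun c => ({a, c, x} : Finset V) ∈ H ∧ ({b, c, x} : Finset V) ∈ H)
    refine hfree' (aux_K12q (2 * t) H x a b Y ?_ ?_ hab ?_ ?_ ?_ ?_ ?_)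
    · rintro rfl; exact nAC _ ha hx
    · rintro rfl; exact nAC _ hb hx
    · exact fun h => nBC _ (Finset.mem_filter.1 h).1 hx
    · exact fun h => nAB _ ha (Finset.mem_filter.1 h).1
    · exact fun h => nAB _ hb (Finset.mem_filter.1 h).1
    · intro y hy
      rw [Finset.insert_comm x a, Finset.insert_comm x b, Finset.pair_comm x y]
      exact (Finset.mem_filter.1 hy).2
    · refine le_trans (show 2 * t ≤ _ from Nat.le_of_pred_lt (not_le.1 hcon)) (Finset.card_le_card_of_injOn (t := Y) Prod.fst ?_ ?_)
      · intro p hp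
        simp only [Finset.coe_filter, Finset.mem_filter, Finset.mem_product, Set.mem_ofPred_eq] at hp
        obtain ⟨⟨⟨h1, h2⟩, h3, h4⟩, rfl⟩ := hp
        simp only [Y, Finset.coe_filter, Set.mem_ofPred_eq]
        exact ⟨h1, h3, h4⟩
      · intro p hp p2 hp2 h
        simp only [Finset.coe_filter, Finset.mem_filter, Finset.mem_product, Set.mem_ofPred_eq] at hp hp2
        exact Prod.ext h (hp.2.trans hp2.2.symm)

theorem aux_count {V : Type*} [DecidableEq V]
    (A B C : Finset V) (H : Finset (Finset V))
    (hpart : ∀ e ∈ H, e ⊆ A ∪ B ∪ C ∧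
      (e ∩ A).card = 1 ∧ (e ∩ B).card = 1 ∧ (e ∩ C).card = 1) :
    H.card ≤ ∑ p ∈ B ×ˢ C, (A.filter (fun a => ({a, p.1, p.2} : Finset V) ∈ H)).card := by
  rw [← Finset.card_sigma]
  apply Finset.card_le_card_of_surjOn (fun s => ({s.2, s.1.1, s.1.2} : Finset V))
  intro e he
  obtain ⟨h0, h1, h2, h3⟩ := hpart e he
  obtain ⟨a, ha⟩ := Finset.card_eq_one.1 h1
  obtain ⟨b, hb⟩ := Finset.card_eq_one.1 h2
  obtain ⟨c, hc⟩ := Finset.card_eq_one.1 h3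
  have ha' : a ∈ e ∩ A := by simp [ha]
  have hb' : b ∈ e ∩ B := by simp [hb]
  have hc' : c ∈ e ∩ C := by simp [hc]
  rw [Finset.mem_inter] at ha' hb' hc'
  have heq : ({a, b, c} : Finset V) = e := by
    have : e = e ∩ A ∪ e ∩ B ∪ e ∩ C := by
      rw [← Finset.inter_union_distrib_left, ← Finset.inter_union_distrib_left]
      exact (Finset.inter_eq_left.2 h0).symm
    rw [this, ha, hb, hc]
    ext v
    simp [or_assoc]
  refine ⟨⟨(b, c), a⟩, ?_, heq⟩
  simp only [Finset.coe_sigma, Set.mem_sigma_iff, Finset.mem_coe, Finset.mem_product,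
    Finset.mem_filter]
  exact ⟨⟨hb'.2, hc'.2⟩, ha'.2, by rw [heq]; exact he⟩

/-- Let `t ≥ 2` and let `H` be a 3-partite 3-uniform hypergraph with parts `A`, `B`,
`C`, each of size `n`.  If `H` contains no copy of `K_{2,t}^{(3)}` and no copy of
`K_{1,2,2t}`, then `H` has at most `2·t·n²` edges. -/
theorem K2t3_K122t_free_upper {V : Type*} [DecidableEq V] (t n : ℕ) (ht : 2 ≤ t)
    (A B C : Finset V)
    (hAB : Disjoint A B) (hAC : Disjoint A C) (hBC : Disjoint B C)
    (hA : A.card = n) (hB : B.card = n) (hC : C.card = n)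
    (H : Finset (Finset V))
    (hpart : ∀ e ∈ H, e ⊆ A ∪ B ∪ C ∧
      (e ∩ A).card = 1 ∧ (e ∩ B).card = 1 ∧ (e ∩ C).card = 1)
    (hfree : ¬ hasK2t3 t H) (hfree' : ¬ hasK12q (2 * t) H) :
    H.card ≤ 2 * t * n ^ 2 := by
  classical
  have hE := aux_count A B C H hpart
  set d : V × V → ℕ := fun p => (A.filter (fun a => ({a, p.1, p.2} : Finset V) ∈ H)).card with hd
  have hdc := Finset.sum_card_bipartiteAbove_eq_sum_card_bipartiteBelow
    (s := A.offDiag) (t := B ×ˢ C)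
    (fun (q : V × V) (p : V × V) => ({q.1, p.1, p.2} : Finset V) ∈ H ∧
      ({q.2, p.1, p.2} : Finset V) ∈ H)
  have hup : ∑ q ∈ A.offDiag, (Finset.bipartiteAbove (fun (q : V × V) (p : V × V) =>
      ({q.1, p.1, p.2} : Finset V) ∈ H ∧ ({q.2, p.1, p.2} : Finset V) ∈ H) (B ×ˢ C) q).card
      ≤ A.offDiag.card * ((t - 1) * ((2 * t - 1) + (2 * t - 1))) := by
    rw [← smul_eq_mul]
    apply Finset.sum_le_card_nsmul
    intro q hq
    rw [Finset.mem_offDiag] at hq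
    exact aux_codeg t ht A B C hAB hAC hBC H hfree hfree' q.1 q.2 hq.1 hq.2.1 hq.2.2
  have hlow : ∀ p ∈ B ×ˢ C, (Finset.bipartiteBelow (fun (q : V × V) (p : V × V) =>
      ({q.1, p.1, p.2} : Finset V) ∈ H ∧ ({q.2, p.1, p.2} : Finset V) ∈ H) A.offDiag p).card
      = d p * d p - d p := by
    intro p _
    rw [hd, ← Finset.offDiag_card]
    congr 1
    ext q
    simp only [Finset.bipartiteBelow, Finset.mem_filter, Finset.mem_offDiag]
    tauto
  rw [hdc, Finset.sum_congr rfl hlow, Finset.offDiag_card, hA] at hup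
  have hup2 : ∑ p ∈ B ×ˢ C, (d p * d p - d p) ≤
      n * n * ((t - 1) * ((2 * t - 1) + (2 * t - 1))) :=
    hup.trans (Nat.mul_le_mul_right _ (Nat.sub_le _ _))
  have hup3 : ∑ p ∈ B ×ˢ C, ((d p : ℤ) * d p - d p) ≤
      n * n * ((t - 1) * (2 * (2 * t - 1))) := by
    have h : ((∑ p ∈ B ×ˢ C, (d p * d p - d p) : ℕ) : ℤ) ≤
      ((n * n * ((t - 1) * ((2 * t - 1) + (2 * t - 1))) : ℕ) : ℤ) := by exact_mod_cast hup2
    rw [Nat.cast_sum] at h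
    have h5 : ∀ p ∈ B ×ˢ C, ((d p * d p - d p : ℕ) : ℤ) = (d p : ℤ) * d p - d p := by
      intro p _
      rw [Nat.cast_sub (Nat.le_mul_self _)]
      push_cast
      rfl
    rw [Finset.sum_congr rfl h5] at h
    push_cast [Nat.cast_sub (show 1 ≤ t by omega), Nat.cast_sub (show 1 ≤ 2 * t by omega)] at h
    linarith
  have htan : ∑ p ∈ B ×ˢ C, ((4 * t - 1 : ℤ) * d p - 4 * t * t) ≤
      ∑ p ∈ B ×ˢ C, ((d p : ℤ) * d p - d p) := by
    apply Finset.sum_le_sum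
    intro p _
    nlinarith [sq_nonneg ((d p : ℤ) - 2 * t)]
  rw [Finset.sum_sub_distrib, ← Finset.mul_sum, Finset.sum_const, Finset.card_product, hB, hC]
    at htan
  have hE' : (H.card : ℤ) ≤ ∑ p ∈ B ×ˢ C, (d p : ℤ) := by exact_mod_cast hE
  have ht' : (2 : ℤ) ≤ t := by exact_mod_cast ht
  have hfin : (H.card : ℤ) ≤ 2 * t * n ^ 2 := by
    refine hE'.trans ?_
    simp only [nsmul_eq_mul, Nat.cast_mul] at htan
    generalize (∑ p ∈ B ×ˢ C, (d p : ℤ)) = E at *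
    have h7 : (4 * t - 1 : ℤ) * E ≤ (4 * t - 1) * (2 * t * n ^ 2) := by
      have hn : (0 : ℤ) ≤ (n : ℤ) * n := by positivity
      nlinarith [mul_nonneg hn (show (0 : ℤ) ≤ t - 2 by linarith)]
    exact le_of_mul_le_mul_left h7 (by linarith)
  exact_mod_cast hfin
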